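/- arXiv:math/9802018 — 3 statements merged into one kernel-verified Lean document; each statement's English description precedes it below -/
import Mathlib

section
/- Let S = ℂ[x_0,…,x_d] be the polynomial ring in d+1 variables (d ≥ 1) and I = ⟨x_0,…,x_d⟩ the ideal generated by all the variables. Then the local cohomology modules of S with respect to I vanish in all degrees except the top one: H^p_I(S) = 0 for all p ≠ d+1. -/
open CategoryTheory Limits

noncomputable section

/-- The `Ext` modules computed from projective resolutions vanish where the `Ext` groups of the
derived category do. -/
lemma isZero_ext_obj_of_subsingleton {A : Type*} [Ring A] {C : Type*} [Category* C] [Abelian C]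
    [Linear A C] [EnoughProjectives C] [HasExt C] (X Y : C) (n : ℕ)
    (h : Subsingleton (Abelian.Ext X Y n)) :
    IsZero (((Ext A C n).obj (Opposite.op X)).obj Y) := by
  let P := projectiveResolution X
  refine IsZero.of_iso ?_ (P.isoExt n Y)
  rw [← HomologicalComplex.exactAt_iff_isZero_homology]
  cases n with
  | zero =>
    rw [HomologicalComplex.exactAt_iff' _ 0 0 1 (by simp) (by simp),
      ShortComplex.moduleCat_exact_iff]
    intro (f : P.complex.X 0 ⟶ Y) (hf : P.complex.d 1 0 ≫ f = 0)
    refine ⟨0, ?_⟩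
    obtain ⟨g, hg⟩ := CokernelCofork.IsColimit.desc' P.isColimitCokernelCofork f hf
    have : Subsingleton (X ⟶ Y) := Abelian.Ext.homEquiv₀.symm.subsingleton
    rw [map_zero, ← hg, show g = 0 from Subsingleton.elim (α := X ⟶ Y) g 0]
    exact comp_zero.symm
  | succ n =>
    rw [HomologicalComplex.exactAt_iff' _ n (n + 1) (n + 2) (by simp) (by simp),
      ShortComplex.moduleCat_exact_iff]
    intro (f : P.complex.X (n + 1) ⟶ Y) (hf : P.complex.d (n + 2) (n + 1) ≫ f = 0)
    exact (P.extMk_eq_zero_iff f (n + 2) rfl hf n rfl).1 (Subsingleton.elim _ _)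

/-- Local cohomology vanishes if all the `Ext` groups in the defining colimit do. -/
lemma isZero_localCohomology_obj {R : Type*} [CommRing R] (J : Ideal R) (M : ModuleCat R) (i : ℕ)
    (h : ∀ t : ℕ, Subsingleton (Abelian.Ext (ModuleCat.of R (R ⧸ J ^ t)) M i)) :
    IsZero ((localCohomology J i).obj M) := by
  have hz (t : (ℕᵒᵖ)ᵒᵖ) :
      IsZero (((localCohomology.diagram (localCohomology.idealPowersDiagram J) i).obj t).obj M) :=
    isZero_ext_obj_of_subsingleton _ _ _ (h t.unop.unop)
  have := localCohomology.hasColimitDiagram (localCohomology.idealPowersDiagram J) i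
  rw [IsZero.iff_id_eq_zero]
  exact (isColimitOfPreserves ((evaluation _ _).obj M) (colimit.isColimit
    (localCohomology.diagram (localCohomology.idealPowersDiagram J) i))).hom_ext
    fun t ↦ (hz t).eq_of_src _ _

namespace ModuleCat
open RingTheory.Sequence
universe u

variable {R : Type u} [CommRing R]

/-- Quotienting by a weakly regular sequence raises the projective dimension by at most its
length. -/
lemma hasProjectiveDimensionLT_quotient_of_isWeaklyRegular (M : ModuleCat.{u} R) (n : ℕ)
    (rs : List R) (reg : IsWeaklyRegular M rs) (h : HasProjectiveDimensionLT M (n + 1)) :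
    HasProjectiveDimensionLT
      (ModuleCat.of R (M ⧸ Ideal.ofList rs • (⊤ : Submodule R M))) (n + 1 + rs.length) := by
  induction rs generalizing M n with
  | nil =>
    refine hasProjectiveDimensionLT_of_iso (X := M) (LinearEquiv.toModuleIso ?_) _
    exact (Submodule.quotEquivOfEqBot _ (by simp)).symm
  | cons x rs ih =>
    rw [isWeaklyRegular_cons_iff] at reg
    have hq := reg.1.smulShortComplex_shortExact.hasProjectiveDimensionLT_X₃ (n + 1) h
      (hasProjectiveDimensionLT_of_ge M (n + 1) (n + 2) (by lia))
    have := ih (ModuleCat.of R (QuotSMulTop x M)) (n + 1) reg.2 hq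
    rw [List.length_cons, show n + 1 + (rs.length + 1) = n + 1 + 1 + rs.length by lia]
    exact hasProjectiveDimensionLT_of_iso
      (Submodule.quotOfListConsSMulTopEquivQuotSMulTopInner M x rs).symm.toModuleIso _

/-- Over a Noetherian ring, a finite module killed by a power of a maximal ideal has at most the
projective dimension of the residue field. -/
lemma hasProjectiveDimensionLT_of_pow_le_annihilator [IsNoetherianRing R] (I : Ideal R)
    [hI : I.IsMaximal] (n : ℕ) (h : HasProjectiveDimensionLT (ModuleCat.of R (R ⧸ I)) n)
    {M : Type u} [AddCommGroup M] [Module R M] [Module.Finite R M] (t : ℕ)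
    (hM : I ^ t ≤ Module.annihilator R M) : HasProjectiveDimensionLT (ModuleCat.of R M) n := by
  induction ‹Module.Finite R M› using IsNoetherianRing.induction_on_isQuotientEquivQuotientPrime R
    with
  | subsingleton N =>
    have := (ModuleCat.isZero_of_subsingleton (ModuleCat.of R N)).hasProjectiveDimensionLT_zero
    exact hasProjectiveDimensionLT_of_ge _ 0 n n.zero_le
  | quotient N q e =>
    rw [e.annihilator_eq, Ideal.annihilator_quotient] at hM
    obtain rfl : I = q.1 := hI.eq_of_le q.2.ne_top (q.2.le_of_pow_le hM)
    exact hasProjectiveDimensionLT_of_iso e.symm.toModuleIso n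
  | exact N₁ N₂ N₃ f g hf hg hfg h₁ h₃ =>
    have hT : (shortComplexOfCompEqZero f g hfg.linearMap_comp_eq_zero).ShortExact :=
      shortComplex_shortExact _ hfg hf hg
    exact hT.hasProjectiveDimensionLT_X₂ n
      (h₁ (hM.trans (f.annihilator_le_of_injective hf)))
      (h₃ (hM.trans (g.annihilator_le_of_surjective hg)))

end ModuleCat

namespace MvPolynomial
open RingTheory.Sequence

lemma isWeaklyRegular_ofFn_X (k : Type*) [CommRing k] (n : ℕ) :
    IsWeaklyRegular (MvPolynomial (Fin n) k)
      (List.ofFn (X : Fin n → MvPolynomial (Fin n) k)) := by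
  rw [isWeaklyRegular_iff_Fin]
  rintro ⟨i, hi⟩
  have hi' : i < n := by simpa using hi
  have key : Ideal.ofList ((List.ofFn (X : Fin n → MvPolynomial (Fin n) k)).take i) =
      Ideal.span (X '' {j : Fin n | (j : ℕ) < i}) := by
    refine congrArg Ideal.span (Set.ext fun f ↦ ?_)
    simp only [Set.mem_ofPred_eq, List.mem_take_iff_getElem, Set.mem_image]
    constructor
    · rintro ⟨j, hj, rfl⟩
      exact ⟨⟨j, by lia⟩, by simp; lia, by simp⟩
    · rintro ⟨j, hj, rfl⟩
      exact ⟨j, by simp; lia, by simp⟩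
  rw [isSMulRegular_quotient_iff_mem_of_smul_mem]
  simp only [key, smul_eq_mul, Ideal.mul_top, Fin.getElem_fin, List.getElem_ofFn,
    mem_ideal_span_X_image]
  intro f hf m hm
  obtain ⟨j, hj, hjm⟩ := hf (Finsupp.single ⟨i, hi'⟩ 1 + m) (by
    rw [mem_support_iff, coeff_X_mul]; exact mem_support_iff.1 hm)
  refine ⟨j, hj, ?_⟩
  have : (⟨i, hi'⟩ : Fin n) ≠ j := by rintro rfl; simp at hj
  simpa [Finsupp.single_apply, this] using hjm

lemma isMaximal_span_range_X (σ k : Type*) [Field k] :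
    (Ideal.span (Set.range (X : σ → MvPolynomial σ k))).IsMaximal := by
  have : Ideal.span (Set.range (X : σ → MvPolynomial σ k)) =
      RingHom.ker (constantCoeff : MvPolynomial σ k →+* k) := by
    ext f
    rw [← Set.image_univ, mem_ideal_span_X_image, RingHom.mem_ker, constantCoeff_eq,
      ← notMem_support_iff]
    refine ⟨fun h h0 ↦ by simpa using h 0 h0, fun h m hm ↦ ?_⟩
    by_contra! h'
    exact h ((show m = 0 from Finsupp.ext fun i ↦ h' i trivial) ▸ hm)
  rw [this]
  exact RingHom.ker_isMaximal_of_surjective _ fun a ↦ ⟨C a, constantCoeff_C _ _⟩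

end MvPolynomial

/-- Local cohomology of `S = ℂ[x_0,…,x_d]` with support in the irrelevant ideal
`I = ⟨x_0,…,x_d⟩` vanishes in all degrees except the top degree `d + 1`. -/
theorem localCohomology_polynomial_ring_vanishing (d : ℕ) (hd : 1 ≤ d) (p : ℕ)
    (hp : p ≠ d + 1) :
    IsZero ((localCohomology
        (Ideal.span (Set.range (MvPolynomial.X : Fin (d + 1) →
          MvPolynomial (Fin (d + 1)) ℂ))) p).obj
      (ModuleCat.of (MvPolynomial (Fin (d + 1)) ℂ) (MvPolynomial (Fin (d + 1)) ℂ))) := by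
  set S := MvPolynomial (Fin (d + 1)) ℂ
  set I : Ideal S := Ideal.span (Set.range MvPolynomial.X)
  have hmax : I.IsMaximal := MvPolynomial.isMaximal_span_range_X _ _
  set rs : List S := List.ofFn MvPolynomial.X
  have hreg : RingTheory.Sequence.IsWeaklyRegular S rs :=
    MvPolynomial.isWeaklyRegular_ofFn_X ℂ (d + 1)
  have hlen : rs.length = d + 1 := List.length_ofFn
  have hIrs : Ideal.ofList rs = I := congrArg Ideal.span (Set.ext fun f ↦ List.mem_ofFn' _ f)
  have hlt : I • (⊤ : Submodule S S) < ⊤ := by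
    simpa [lt_top_iff_ne_top] using hmax.ne_top
  refine isZero_localCohomology_obj I _ p fun t ↦ ?_
  have hann : I ^ t ≤ Module.annihilator S (S ⧸ I ^ t) := (Ideal.annihilator_quotient).ge
  obtain hp | hp := hp.lt_or_gt
  · refine ModuleCat.subsingleton_ext_of_exists_isRegular I _ ?_ (ModuleCat.of S S) hlt rs
      ?_ ⟨hreg, ?_⟩ p (hlen ▸ hp)
    · rw [Module.support_eq_zeroLocus, PrimeSpectrum.zeroLocus_subset_zeroLocus_iff]
      exact fun x hx ↦ ⟨t, hann (Ideal.pow_mem_pow hx t)⟩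
    · exact fun r hr ↦ hIrs ▸ Ideal.subset_span hr
    · rw [hIrs]; exact hlt.ne'
  · have h1 := ModuleCat.hasProjectiveDimensionLT_quotient_of_isWeaklyRegular (ModuleCat.of S S) 0
      rs hreg inferInstance
    have h2 : HasProjectiveDimensionLT (ModuleCat.of S (S ⧸ I)) (d + 2) := by
      rw [show d + 2 = 0 + 1 + rs.length by lia]
      exact hasProjectiveDimensionLT_of_iso (LinearEquiv.toModuleIso
        (Submodule.quotEquivOfEq (Ideal.ofList rs • (⊤ : Submodule S S)) I
          (by rw [hIrs, smul_eq_mul, Ideal.mul_top]))) _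
    have h3 := ModuleCat.hasProjectiveDimensionLT_of_pow_le_annihilator I (d + 2) h2 t hann
    exact h3.subsingleton _ _ p (by lia) _
end
end

section
/- Let R be a commutative ring and let R^q →^α R^p →^π M → 0 and R^ℓ →^β R^k →^{π'} N → 0 be exact sequences of R-modules (free presentations of M and N). Let β_*: Hom_R(R^p,R^ℓ) → Hom_R(R^p,R^k) and β̃_*: Hom_R(R^q,R^ℓ) → Hom_R(R^q,R^k) denote post-composition with β, and let α̃^*: Hom_R(R^p,R^k) → Hom_R(R^q,R^k)/Im(β̃_*) send ψ to the class of ψ∘α. Then Im(β_*) ⊆ Ker(α̃^*), and there is an isomorphism of R-modules Hom_R(M,N) ≅ Ker(α̃^*)/Im(β_*), under which a class [ψ] with ψ ∈ Ker(α̃^*) corresponds to the unique homomorphism φ: M → N satisfying φ∘π = π'∘ψ. -/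
noncomputable section

universe u v w

variable {R : Type u} [CommRing R]

/-- Post-composition with `β : R^ℓ → R^k`, as a linear map
`Hom(R^p, R^ℓ) → Hom(R^p, R^k)`. -/
def postComp {p l k : ℕ} (β : (Fin l → R) →ₗ[R] (Fin k → R)) :
    ((Fin p → R) →ₗ[R] (Fin l → R)) →ₗ[R] ((Fin p → R) →ₗ[R] (Fin k → R)) :=
  LinearMap.llcomp R (Fin p → R) (Fin l → R) (Fin k → R) β

/-- The map `α̃^* : Hom(R^p, R^k) → Hom(R^q, R^k)/Im(β̃_*)` sending `ψ` to the class of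
`ψ ∘ α`. -/
def alphaTilde {p q l k : ℕ} (α : (Fin q → R) →ₗ[R] (Fin p → R))
    (β : (Fin l → R) →ₗ[R] (Fin k → R)) :
    ((Fin p → R) →ₗ[R] (Fin k → R)) →ₗ[R]
      (((Fin q → R) →ₗ[R] (Fin k → R)) ⧸ LinearMap.range (postComp (p := q) β)) :=
  (Submodule.mkQ _).comp (LinearMap.lcomp R (Fin k → R) α)

/-- The quotient instance for submodules of a `Hom`-module (this is exactly
`Submodule.hasQuotient`; it is restated to help instance resolution). -/
instance linMapSubQuotient {p k : ℕ} (K : Submodule R ((Fin p → R) →ₗ[R] (Fin k → R))) :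
    HasQuotient (↥K) (Submodule R ↥K) :=
  @Submodule.hasQuotient R ↥K _ _ _

theorem mem_range_postComp_iff {N : Type w} [AddCommGroup N] [Module R N] {p l k : ℕ}
    {β : (Fin l → R) →ₗ[R] (Fin k → R)} {π' : (Fin k → R) →ₗ[R] N}
    (hβ : Function.Exact β π') (ψ : (Fin p → R) →ₗ[R] (Fin k → R)) :
    ψ ∈ LinearMap.range (postComp (p := p) β) ↔ π'.comp ψ = 0 := by
  constructor
  · rintro ⟨χ, rfl⟩
    exact LinearMap.ext fun x => hβ.apply_apply_eq_zero _
  · intro h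
    have hψ (x) : ψ x ∈ LinearMap.range β := (hβ _).1 (LinearMap.congr_fun h x)
    obtain ⟨χ, hχ⟩ := Module.projective_lifting_property β.rangeRestrict
      (ψ.codRestrict (LinearMap.range β) hψ) β.surjective_rangeRestrict
    exact ⟨χ, LinearMap.ext fun x => congrArg Subtype.val (LinearMap.congr_fun hχ x)⟩

theorem mem_ker_alphaTilde_iff {N : Type w} [AddCommGroup N] [Module R N] {p q l k : ℕ}
    (α : (Fin q → R) →ₗ[R] (Fin p → R))
    {β : (Fin l → R) →ₗ[R] (Fin k → R)} {π' : (Fin k → R) →ₗ[R] N}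
    (hβ : Function.Exact β π') (ψ : (Fin p → R) →ₗ[R] (Fin k → R)) :
    ψ ∈ LinearMap.ker (alphaTilde α β) ↔ (π'.comp ψ).comp α = 0 := by
  rw [LinearMap.comp_assoc, ← mem_range_postComp_iff hβ, LinearMap.mem_ker]
  exact Submodule.Quotient.mk_eq_zero _

theorem exists_quotient_equiv_of_eq_ker {A B : Type*} [AddCommGroup A] [Module R A]
    [AddCommGroup B] [Module R B] {g : A →ₗ[R] B} (hg : Function.Surjective g)
    {K : Submodule R A} (hK : K = LinearMap.ker g) :
    ∃ e : (A ⧸ K) ≃ₗ[R] B, ∀ a, e (Submodule.Quotient.mk a) = g a :=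
  ⟨(Submodule.quotEquivOfEq _ _ hK).trans (g.quotKerEquivOfSurjective hg), fun _ => rfl⟩

/-- A linear map vanishing on the image of `α` factors through the cokernel `π` of `α`. -/
theorem exists_comp_eq_of_exact {A B M N : Type*} [AddCommGroup A] [Module R A]
    [AddCommGroup B] [Module R B] [AddCommGroup M] [Module R M] [AddCommGroup N] [Module R N]
    {α : A →ₗ[R] B} {π : B →ₗ[R] M} (hα : Function.Exact α π) (hπ : Function.Surjective π)
    {f : B →ₗ[R] N} (hf : f.comp α = 0) : ∃ φ : M →ₗ[R] N, φ.comp π = f := by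
  have hle : LinearMap.ker π ≤ LinearMap.ker f := by
    rw [hα.linearMap_ker_eq]
    exact LinearMap.range_le_ker_iff.2 hf
  refine ⟨((LinearMap.ker π).liftQ f hle).comp
    (π.quotKerEquivOfSurjective hπ).symm.toLinearMap, LinearMap.ext fun x => ?_⟩
  have : (π.quotKerEquivOfSurjective hπ).symm (π x) = Submodule.Quotient.mk x :=
    (LinearEquiv.symm_apply_eq _).2 rfl
  simp [this]

/-- Computation of `Hom_R(M, N)` from free presentations `R^q →^α R^p →^π M → 0` and
`R^ℓ →^β R^k →^{π'} N → 0`: one has `Im(β_*) ⊆ Ker(α̃^*)` and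
`Hom_R(M, N) ≅ Ker(α̃^*)/Im(β_*)`, the class of `ψ` corresponding to the unique
`φ : M → N` with `φ ∘ π = π' ∘ ψ`. -/
theorem hom_from_presentations
    (M : Type v) [AddCommGroup M] [Module R M]
    (N : Type w) [AddCommGroup N] [Module R N]
    (p q l k : ℕ)
    (α : (Fin q → R) →ₗ[R] (Fin p → R)) (π : (Fin p → R) →ₗ[R] M)
    (hα : Function.Exact α π) (hπ : Function.Surjective π)
    (β : (Fin l → R) →ₗ[R] (Fin k → R)) (π' : (Fin k → R) →ₗ[R] N)
    (hβ : Function.Exact β π') (hπ' : Function.Surjective π') :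
    LinearMap.range (postComp (p := p) β) ≤ LinearMap.ker (alphaTilde α β) ∧
    ∃ e : (↥(LinearMap.ker (alphaTilde α β)) ⧸
        (Submodule.comap (LinearMap.ker (alphaTilde α β)).subtype
          (LinearMap.range (postComp (p := p) β)))) ≃ₗ[R] (M →ₗ[R] N),
      ∀ (ψ : (Fin p → R) →ₗ[R] (Fin k → R)) (hψ : ψ ∈ LinearMap.ker (alphaTilde α β)),
        (e (Submodule.Quotient.mk ⟨ψ, hψ⟩)).comp π = π'.comp ψ := by
  have hinj : Function.Injective (LinearMap.lcomp R N π) := fun f g h =>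
    (LinearMap.cancel_right hπ).1 h
  refine ⟨fun ψ hψ => ?_, ?_⟩
  · rw [mem_ker_alphaTilde_iff α hβ, (mem_range_postComp_iff hβ ψ).1 hψ, LinearMap.zero_comp]
  let F : ↥(LinearMap.ker (alphaTilde α β)) →ₗ[R] ((Fin p → R) →ₗ[R] N) :=
    (LinearMap.llcomp R (Fin p → R) (Fin k → R) N π').comp
      (LinearMap.ker (alphaTilde α β)).subtype
  have hF (ψ) : F ψ ∈ LinearMap.range (LinearMap.lcomp R N π) :=
    exists_comp_eq_of_exact hα hπ ((mem_ker_alphaTilde_iff α hβ _).1 ψ.2)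
  let g : ↥(LinearMap.ker (alphaTilde α β)) →ₗ[R] (M →ₗ[R] N) :=
    (LinearEquiv.ofInjective _ hinj).symm.toLinearMap.comp (F.codRestrict _ hF)
  have hg (ψ) : (g ψ).comp π = π'.comp ψ.1 :=
    congrArg Subtype.val ((LinearEquiv.ofInjective _ hinj).apply_symm_apply (F.codRestrict _ hF ψ))
  have hg_surj : Function.Surjective g := fun φ => by
    obtain ⟨ψ, hψ⟩ := Module.projective_lifting_property π' (φ.comp π) hπ'
    have hψ_mem : ψ ∈ LinearMap.ker (alphaTilde α β) := by
      rw [mem_ker_alphaTilde_iff α hβ, hψ, LinearMap.comp_assoc, hα.linearMap_comp_eq_zero,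
        LinearMap.comp_zero]
    exact ⟨⟨ψ, hψ_mem⟩, hinj ((hg _).trans hψ)⟩
  have hg_ker : Submodule.comap (LinearMap.ker (alphaTilde α β)).subtype
      (LinearMap.range (postComp (p := p) β)) = LinearMap.ker g := by
    ext ψ
    rw [Submodule.mem_comap, LinearMap.mem_ker, Submodule.subtype_apply,
      mem_range_postComp_iff hβ, ← hg, ← LinearMap.zero_comp π, LinearMap.cancel_right hπ]
  obtain ⟨e, he⟩ := exists_quotient_equiv_of_eq_ker
    (A := ↥(LinearMap.ker (alphaTilde α β))) (g := g) hg_surj hg_ker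
  exact ⟨e, fun ψ hψ => (congrArg (·.comp π) (he ⟨ψ, hψ⟩)).trans (hg ⟨ψ, hψ⟩)⟩
end
end

section
/- Let S = ℂ[x_1,…,x_7] and for each integer m ≥ 1 let J_m be the ideal generated by the m-th powers of the ten monomials x_6x_7, x_4x_6, x_3x_6, x_2x_6, x_1x_6, x_5x_7, x_4x_5, x_3x_5, x_2x_5, x_1x_5, i.e. J_m = ⟨(x_6x_7)^m, (x_4x_6)^m, (x_3x_6)^m, (x_2x_6)^m, (x_1x_6)^m, (x_5x_7)^m, (x_4x_5)^m, (x_3x_5)^m, (x_2x_5)^m, (x_1x_5)^m⟩. Then Ext^2_S(S/J_m, S) ≅ S/⟨x_5^m, x_6^m⟩, Ext^3_S(S/J_m, S) = 0, Ext^4_S(S/J_m, S) = 0, Ext^5_S(S/J_m, S) ≅ S/⟨x_1^m, x_2^m, x_3^m, x_4^m, x_7^m⟩, and Ext^6_S(S/J_m, S) ≅ S/⟨x_1^m, x_2^m, x_3^m, x_4^m, x_5^m, x_6^m, x_7^m⟩, as S-modules. -/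
open CategoryTheory Opposite MvPolynomial

noncomputable section

/-- `S = ℂ[x_1, …, x_7]` (with `x_i = X (i-1)`). -/
abbrev S7 : Type := MvPolynomial (Fin 7) ℂ

/-- `J_m`, the ideal generated by the `m`-th powers of the ten monomials
`x_6x_7, x_4x_6, x_3x_6, x_2x_6, x_1x_6, x_5x_7, x_4x_5, x_3x_5, x_2x_5, x_1x_5`. -/
def J7 (m : ℕ) : Ideal S7 :=
  Ideal.span {(X 5 * X 6) ^ m, (X 3 * X 5) ^ m, (X 2 * X 5) ^ m, (X 1 * X 5) ^ m,
    (X 0 * X 5) ^ m, (X 4 * X 6) ^ m, (X 3 * X 4) ^ m, (X 2 * X 4) ^ m,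
    (X 1 * X 4) ^ m, (X 0 * X 4) ^ m}

/-- `Ext^i_S(S/J_m, S)`. -/
abbrev ExtJ7 (i m : ℕ) : Type :=
  ((Ext S7 (ModuleCat S7) i).obj (op (ModuleCat.of S7 (S7 ⧸ J7 m)))).obj
    (ModuleCat.of S7 S7)

namespace CategoryTheory.ProjectiveResolution

open Abelian

variable {R : Type*} [CommRing R] {C : Type*} [Category* C] [Abelian C] [Linear R C]
  [HasExt C] {X : C} (P : ProjectiveResolution X) (Y : C)

lemma smul_extMk {n : ℕ} (r : R) (f : P.complex.X n ⟶ Y) (m : ℕ) (hm : n + 1 = m)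
    (hf : P.complex.d m n ≫ f = 0) :
    r • P.extMk f m hm hf = P.extMk (r • f) m hm (by simp [hf]) := by
  rw [Ext.smul_eq_comp_mk₀, extMk_comp_mk₀]
  simp

variable (R) in
/-- `extMk` as a linear map from the module of cocycles of `Hom(P, Y)`. -/
def extMkLinearMap (n : ℕ) :
    LinearMap.ker ((P.complex.linearYonedaObj R Y).sc' n (n + 1) (n + 2)).g.hom →ₗ[R]
      Ext X Y (n + 1) where
  toFun f := P.extMk (Y := Y) f.1 (n + 2) rfl f.2
  map_add' _ _ := (P.add_extMk _ _ _ _ _ _).symm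
  map_smul' _ _ := (P.smul_extMk Y _ _ _ _ _).symm

variable (R) in
lemma extMkLinearMap_surjective (n : ℕ) :
    Function.Surjective (P.extMkLinearMap R Y n) := fun α ↦ by
  obtain ⟨f, hf, rfl⟩ := P.extMk_surjective α (n + 2) rfl
  exact ⟨⟨f, hf⟩, rfl⟩

variable (R) in
lemma ker_extMkLinearMap (n : ℕ) :
    LinearMap.ker (P.extMkLinearMap R Y n) = LinearMap.range
      ((P.complex.linearYonedaObj R Y).sc' n (n + 1) (n + 2)).moduleCatToCycles := by
  ext ⟨f, hf⟩
  refine (P.extMk_eq_zero_iff (Y := Y) f (n + 2) rfl hf n rfl).trans ?_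
  exact exists_congr fun g ↦ ⟨fun h ↦ Subtype.ext h, fun h ↦ congrArg Subtype.val h⟩

variable (R) in
/-- The derived functor `Ext` agrees, in positive degrees, with the `Ext` modules defined through
the derived category. -/
def extObjLinearEquiv [EnoughProjectives C] (n : ℕ) :
    ((_root_.Ext R C (n + 1)).obj (op X)).obj Y ≃ₗ[R] Ext X Y (n + 1) :=
  let K := P.complex.linearYonedaObj R Y
  (P.isoExt (n + 1) Y ≪≫ ShortComplex.homologyMapIso
      (K.isoSc' n (n + 1) (n + 2) (by simp) (by simp)) ≪≫
      ShortComplex.moduleCatHomologyIso _).toLinearEquiv ≪≫ₗ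
    (Submodule.quotEquivOfEq _ _ (P.ker_extMkLinearMap R Y n)).symm ≪≫ₗ
    (P.extMkLinearMap R Y n).quotKerEquivOfSurjective (P.extMkLinearMap_surjective R Y n)

end CategoryTheory.ProjectiveResolution

namespace CategoryTheory.Abelian.Ext

variable (R : Type*) [CommRing R] {C : Type*} [Category* C] [Abelian C] [Linear R C]
  [HasExt C] (Y : C)

open Pointwise

/-- Precomposition with an `Ext` class, as a linear map. -/
abbrev precompLinear {X X' : C} {a : ℕ} (α : Ext X X' a) {b c : ℕ} (h : a + b = c) :
    Ext X' Y b →ₗ[R] Ext X Y c :=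
  bilinearCompOfLinear R X X' Y a b c h α

variable {R Y} in
lemma subsingleton_of_forall {X : C} {n : ℕ} (h : ∀ x : Ext X Y n, x = 0) :
    Subsingleton (Ext X Y n) :=
  ⟨fun a b ↦ (h a).trans (h b).symm⟩

/-- An isomorphism induces linear equivalences on `Ext`. -/
def precompLinearEquiv {X X' : C} (e : X ≅ X') (n : ℕ) : Ext X' Y n ≃ₗ[R] Ext X Y n :=
  LinearEquiv.ofLinearMap (precompLinear R Y (mk₀ e.hom) (zero_add n))
    (precompLinear R Y (mk₀ e.inv) (zero_add n))
    (by ext x; simp) (by ext x; simp)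

variable {S : ShortComplex C}

lemma subsingleton_X₂ (hS : S.ShortExact) {n : ℕ} [Subsingleton (Ext S.X₁ Y n)]
    [Subsingleton (Ext S.X₃ Y n)] : Subsingleton (Ext S.X₂ Y n) := by
  refine subsingleton_of_forall fun x ↦ ?_
  obtain ⟨y, rfl⟩ := contravariant_sequence_exact₂ hS Y x (Subsingleton.elim _ _)
  rw [Subsingleton.elim y 0, comp_zero]

lemma subsingleton_X₁ (hS : S.ShortExact) {n n' : ℕ} (hn : 1 + n = n') [Subsingleton (Ext S.X₂ Y n)]
    [Subsingleton (Ext S.X₃ Y n')] : Subsingleton (Ext S.X₁ Y n) := by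
  refine subsingleton_of_forall fun x ↦ ?_
  obtain ⟨y, rfl⟩ := contravariant_sequence_exact₁ hS Y x hn (Subsingleton.elim _ _)
  rw [Subsingleton.elim y 0, comp_zero]

lemma nonempty_linearEquiv_X₁_X₂ (hS : S.ShortExact) {n n' : ℕ} (hn : 1 + n = n')
    [Subsingleton (Ext S.X₃ Y n)] [Subsingleton (Ext S.X₃ Y n')] :
    Nonempty (Ext S.X₂ Y n ≃ₗ[R] Ext S.X₁ Y n) := by
  refine ⟨LinearEquiv.ofBijective (precompLinear R Y (mk₀ S.f) (zero_add n)) ⟨?_, fun x ↦ ?_⟩⟩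
  · refine (injective_iff_map_eq_zero _).2 fun x hx ↦ ?_
    obtain ⟨y, rfl⟩ := contravariant_sequence_exact₂ hS Y x hx
    rw [Subsingleton.elim y 0, comp_zero]
  · exact contravariant_sequence_exact₁ hS Y x hn (Subsingleton.elim _ _)

lemma nonempty_linearEquiv_X₂_X₃ (hS : S.ShortExact) {n n' : ℕ} (hn : 1 + n = n')
    [Subsingleton (Ext S.X₁ Y n)] [Subsingleton (Ext S.X₁ Y n')] :
    Nonempty (Ext S.X₂ Y n' ≃ₗ[R] Ext S.X₃ Y n') := by
  refine ⟨(LinearEquiv.ofBijective (precompLinear R Y (mk₀ S.g) (zero_add n'))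
    ⟨?_, fun x ↦ ?_⟩).symm⟩
  · refine (injective_iff_map_eq_zero _).2 fun x hx ↦ ?_
    obtain ⟨y, rfl⟩ := contravariant_sequence_exact₃ hS Y x hx hn
    rw [Subsingleton.elim y 0, comp_zero]
  · exact contravariant_sequence_exact₂ hS Y x (Subsingleton.elim _ _)

lemma nonempty_linearEquiv_X₁_X₃ (hS : S.ShortExact) {n n' : ℕ} (hn : 1 + n = n')
    [Subsingleton (Ext S.X₂ Y n)] [Subsingleton (Ext S.X₂ Y n')] :
    Nonempty (Ext S.X₁ Y n ≃ₗ[R] Ext S.X₃ Y n') := by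
  refine ⟨LinearEquiv.ofBijective (precompLinear R Y hS.extClass hn) ⟨?_, fun x ↦ ?_⟩⟩
  · refine (injective_iff_map_eq_zero _).2 fun x hx ↦ ?_
    obtain ⟨y, rfl⟩ := contravariant_sequence_exact₁ hS Y x hn hx
    rw [Subsingleton.elim y 0, comp_zero]
  · exact contravariant_sequence_exact₃ hS Y x (Subsingleton.elim _ _) hn

section Regular

variable {R Y}
variable {A B : C} {x : R} {g : A ⟶ B} {w : (x • 𝟙 A) ≫ g = 0}

lemma mk₀_comp_eq_zero_of_isSMulRegular {n : ℕ} (w : (x • 𝟙 A) ≫ g = 0)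
    (hreg : IsSMulRegular (Ext A Y n) x) (y : Ext B Y n) :
    (mk₀ g).comp y (zero_add n) = 0 := by
  refine hreg (Eq.trans ?_ (smul_zero x).symm)
  have := congrArg (fun f ↦ (mk₀ f).comp y (zero_add n)) w
  simpa [mk₀_smul] using this

lemma nonempty_linearEquiv_quotSMulTop (hS : (ShortComplex.mk (x • 𝟙 A) g w).ShortExact) {n : ℕ}
    (hreg : IsSMulRegular (Ext A Y (n + 1)) x) :
    Nonempty (Ext B Y (n + 1) ≃ₗ[R] QuotSMulTop x (Ext A Y n)) := by
  let δ : Ext A Y n →ₗ[R] Ext B Y (n + 1) := precompLinear R Y hS.extClass (add_comm 1 n)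
  have hδ : Function.Surjective δ := fun y ↦
    contravariant_sequence_exact₃ hS Y y (mk₀_comp_eq_zero_of_isSMulRegular w hreg y) (add_comm 1 n)
  have hker : LinearMap.ker δ = x • (⊤ : Submodule R (Ext A Y n)) := by
    ext y
    rw [Submodule.mem_smul_pointwise_iff_exists]
    constructor
    · intro hy
      obtain ⟨z, hz⟩ := contravariant_sequence_exact₁ hS Y y (add_comm 1 n) hy
      exact ⟨z, trivial, by simpa [mk₀_smul] using hz⟩
    · rintro ⟨z, -, rfl⟩
      have := hS.extClass_comp_assoc z (h := add_comm 1 n)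
      simpa [mk₀_smul, δ] using this
  exact ⟨(δ.quotKerEquivOfSurjective hδ).symm ≪≫ₗ Submodule.quotEquivOfEq _ _ hker⟩

lemma subsingleton_zero_of_isSMulRegular (hS : (ShortComplex.mk (x • 𝟙 A) g w).ShortExact)
    (hreg : IsSMulRegular (Ext A Y 0) x) : Subsingleton (Ext B Y 0) :=
  subsingleton_of_forall fun y ↦ by
    have : Epi g := hS.epi_g
    apply precomp_mk₀_injective_of_epi Y g
    simpa using mk₀_comp_eq_zero_of_isSMulRegular w hreg y

end Regular

end CategoryTheory.Abelian.Ext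

section

universe u

open Abelian

variable {R : Type u} [CommRing R]

/-- `M` has `Ext^r(M, R) ≅ M`, and `Ext^i(M, R) = 0` for `i ≠ r`. -/
structure IsExtSelfDual (R : Type u) [CommRing R] (M : Type u) [AddCommGroup M] [Module R M]
    (r : ℕ) : Prop where
  nonempty_linearEquiv :
    Nonempty (Ext (ModuleCat.of R M) (ModuleCat.of R R) r ≃ₗ[R] M)
  subsingleton (i : ℕ) (hi : i ≠ r) :
    Subsingleton (Ext (ModuleCat.of R M) (ModuleCat.of R R) i)

namespace IsExtSelfDual

variable {M N : Type u} [AddCommGroup M] [Module R M] [AddCommGroup N] [Module R N] {r : ℕ}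

lemma of_linearEquiv (h : IsExtSelfDual R M r) (e : M ≃ₗ[R] N) : IsExtSelfDual R N r where
  nonempty_linearEquiv := by
    obtain ⟨f⟩ := h.nonempty_linearEquiv
    exact ⟨Ext.precompLinearEquiv R _ e.toModuleIso r ≪≫ₗ f ≪≫ₗ e⟩
  subsingleton i hi :=
    have := h.subsingleton i hi
    (Ext.precompLinearEquiv R _ e.toModuleIso i).symm.toEquiv.symm.subsingleton

lemma self : IsExtSelfDual R R 0 where
  nonempty_linearEquiv := ⟨Ext.linearEquiv₀ (R := R) ≪≫ₗ ModuleCat.homLinearEquiv ≪≫ₗ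
    LinearMap.ringLmapEquivSelf R R R⟩
  subsingleton i hi := by
    obtain ⟨i, rfl⟩ := Nat.exists_eq_succ_of_ne_zero hi
    exact Ext.subsingleton_of_forall fun x ↦ x.eq_zero_of_projective

lemma quotSMulTop (h : IsExtSelfDual R M r) {x : R} (hx : IsSMulRegular M x) :
    IsExtSelfDual R (QuotSMulTop x M) (r + 1) := by
  have hS := IsSMulRegular.smulShortComplex_shortExact (M := ModuleCat.of R M) hx
  obtain ⟨f⟩ := h.nonempty_linearEquiv
  have hreg (i : ℕ) : IsSMulRegular (Ext (ModuleCat.of R M) (ModuleCat.of R R) i) x := by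
    by_cases hi : i = r
    · subst hi
      exact (f.isSMulRegular_congr x).2 hx
    · have := h.subsingleton i hi
      exact fun _ _ _ ↦ Subsingleton.elim _ _
  constructor
  · obtain ⟨e⟩ := Ext.nonempty_linearEquiv_quotSMulTop hS (hreg (r + 1))
    exact ⟨e ≪≫ₗ QuotSMulTop.congr x f⟩
  · rintro (_ | i) hi
    · exact Ext.subsingleton_zero_of_isSMulRegular hS (hreg 0)
    · obtain ⟨e⟩ := Ext.nonempty_linearEquiv_quotSMulTop hS (hreg (i + 1))
      have := h.subsingleton i (by lia)
      have : Subsingleton (QuotSMulTop x (Ext (ModuleCat.of R M) (ModuleCat.of R R) i)) :=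
        (Submodule.mkQ_surjective _).subsingleton
      exact e.toEquiv.subsingleton

lemma quotient_sup_span {I : Ideal R} (h : IsExtSelfDual R (R ⧸ I) r) {x : R}
    (hx : IsSMulRegular (R ⧸ I) x) : IsExtSelfDual R (R ⧸ I ⊔ Ideal.span {x}) (r + 1) := by
  refine (h.quotSMulTop hx).of_linearEquiv (Submodule.quotEquivOfEq _ _ ?_ ≪≫ₗ
    Submodule.quotientQuotientEquivQuotientSup I (Ideal.span {x}))
  rw [← Ideal.mul_top (Ideal.span {x}), ← smul_eq_mul, Submodule.ideal_span_singleton_smul,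
    Submodule.map_pointwise_smul, Submodule.map_top, Submodule.range_mkQ]

end IsExtSelfDual

namespace Ideal

variable (I K : Ideal R)

/-- The kernel of `R/(I ∩ K) → R/I` is isomorphic to the kernel of `R/K → R/(I + K)`. -/
def kerFactorInfEquivKerFactorSup :
    LinearMap.ker (Submodule.factor (inf_le_left : I ⊓ K ≤ I)) ≃ₗ[R]
      LinearMap.ker (Submodule.factor (le_sup_right : K ≤ I ⊔ K)) :=
  LinearEquiv.ofBijective
    ((Submodule.factor (inf_le_right : I ⊓ K ≤ K)).restrict (by
      rintro x hx
      obtain ⟨x, rfl⟩ := Submodule.mkQ_surjective _ x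
      rw [LinearMap.mem_ker, Submodule.factor_mk, Submodule.mkQ_apply,
        Submodule.Quotient.mk_eq_zero] at hx
      rw [LinearMap.mem_ker, Submodule.factor_mk, Submodule.factor_mk, Submodule.mkQ_apply,
        Submodule.Quotient.mk_eq_zero]
      exact le_sup_left (a := I) hx)) (by
    constructor
    · refine (injective_iff_map_eq_zero _).2 ?_
      rintro ⟨x, hx⟩ hx'
      obtain ⟨x, rfl⟩ := Submodule.mkQ_surjective _ x
      rw [LinearMap.mem_ker, Submodule.factor_mk, Submodule.mkQ_apply,
        Submodule.Quotient.mk_eq_zero] at hx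
      replace hx' : Submodule.factor (inf_le_right : I ⊓ K ≤ K) (Submodule.mkQ _ x) = 0 :=
        congrArg Subtype.val hx'
      rw [Submodule.factor_mk, Submodule.mkQ_apply, Submodule.Quotient.mk_eq_zero] at hx'
      exact Subtype.ext ((Submodule.Quotient.mk_eq_zero _).2 ⟨hx, hx'⟩)
    · rintro ⟨x, hx⟩
      obtain ⟨x, rfl⟩ := Submodule.mkQ_surjective _ x
      rw [LinearMap.mem_ker, Submodule.factor_mk, Submodule.mkQ_apply,
        Submodule.Quotient.mk_eq_zero, Submodule.mem_sup] at hx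
      obtain ⟨y, hy, z, hz, rfl⟩ := hx
      refine ⟨⟨Submodule.Quotient.mk y, ?_⟩, Subtype.ext ?_⟩
      · rwa [LinearMap.mem_ker, ← Submodule.mkQ_apply, Submodule.factor_mk, Submodule.mkQ_apply,
          Submodule.Quotient.mk_eq_zero]
      · change Submodule.factor (inf_le_right : I ⊓ K ≤ K) (Submodule.mkQ _ y) =
          Submodule.mkQ K (y + z)
        rw [Submodule.factor_mk, Submodule.mkQ_apply, Submodule.mkQ_apply, Submodule.Quotient.eq,
          sub_add_cancel_left, neg_mem_iff]
        exact hz)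

/-- If `R/I`, `R/K` and `R/(I + K)` each have a single nonzero `Ext` module into `R`, in degrees
`a`, `b` and `b + 2` respectively, with `0 < a` and `a + 2 ≤ b`, then the `Ext` modules of
`R/(I ∩ K)` are determined. -/
lemma ext_quotient_inf {a b : ℕ} (hI : IsExtSelfDual R (R ⧸ I) a)
    (hK : IsExtSelfDual R (R ⧸ K) b) (hIK : IsExtSelfDual R (R ⧸ I ⊔ K) (b + 2))
    (ha : 0 < a) (hab : a + 2 ≤ b) :
    let E (i : ℕ) := Ext (ModuleCat.of R (R ⧸ I ⊓ K)) (ModuleCat.of R R) i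
    Nonempty (E a ≃ₗ[R] R ⧸ I) ∧ Nonempty (E b ≃ₗ[R] R ⧸ K) ∧
      Nonempty (E (b + 1) ≃ₗ[R] R ⧸ I ⊔ K) ∧
      ∀ i, i ≠ a → i ≠ b → i ≠ b + 1 → Subsingleton (E i) := by
  intro E
  have hS := LinearMap.shortExact_shortComplexKer
    (Submodule.factor_surjective (inf_le_left : I ⊓ K ≤ I))
  have hT := LinearMap.shortExact_shortComplexKer
    (Submodule.factor_surjective (le_sup_right : K ≤ I ⊔ K))
  let N := ModuleCat.of R (LinearMap.ker (Submodule.factor (inf_le_left : I ⊓ K ≤ I)))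
  let F (i : ℕ) : Ext _ (ModuleCat.of R R) i ≃ₗ[R] Ext N (ModuleCat.of R R) i :=
    Ext.precompLinearEquiv R _ (kerFactorInfEquivKerFactorSup I K).toModuleIso i
  have hN (i : ℕ) (hi : i ≠ b) (hi' : i ≠ b + 1) : Subsingleton (Ext N (ModuleCat.of R R) i) := by
    have := hK.subsingleton i hi
    have := hIK.subsingleton (1 + i) (by lia)
    have := Ext.subsingleton_X₁ (Y := ModuleCat.of R R) hT (rfl : 1 + i = _)
    exact (F i).symm.toEquiv.subsingleton
  have hN₁ : Nonempty (Ext N (ModuleCat.of R R) b ≃ₗ[R] R ⧸ K) := by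
    have := hIK.subsingleton b (by lia)
    have := hIK.subsingleton (1 + b) (by lia)
    obtain ⟨e⟩ := Ext.nonempty_linearEquiv_X₁_X₂ R (ModuleCat.of R R) hT (rfl : 1 + b = _)
    obtain ⟨f⟩ := hK.nonempty_linearEquiv
    exact ⟨(F b).symm ≪≫ₗ e.symm ≪≫ₗ f⟩
  have hN₂ : Nonempty (Ext N (ModuleCat.of R R) (b + 1) ≃ₗ[R] R ⧸ I ⊔ K) := by
    have := hK.subsingleton (b + 1) (by lia)
    have := hK.subsingleton (b + 2) (by lia)
    obtain ⟨e⟩ := Ext.nonempty_linearEquiv_X₁_X₃ R (ModuleCat.of R R) hT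
      (add_comm 1 (b + 1) : _ = b + 2)
    obtain ⟨f⟩ := hIK.nonempty_linearEquiv
    exact ⟨(F (b + 1)).symm ≪≫ₗ e ≪≫ₗ f⟩
  have key (i : ℕ) (hi : a < i) : Nonempty (E i ≃ₗ[R] Ext N (ModuleCat.of R R) i) := by
    have := hI.subsingleton i (by lia)
    have := hI.subsingleton (1 + i) (by lia)
    exact Ext.nonempty_linearEquiv_X₁_X₂ R (ModuleCat.of R R) hS (rfl : 1 + i = _)
  refine ⟨?_, ?_, ?_, fun i hia hib hib' ↦ ?_⟩
  · obtain ⟨f⟩ := hI.nonempty_linearEquiv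
    have := hN a (by lia) (by lia)
    have := hN (a - 1) (by lia) (by lia)
    obtain ⟨e⟩ := Ext.nonempty_linearEquiv_X₂_X₃ R (ModuleCat.of R R) hS
      (by lia : 1 + (a - 1) = a)
    exact ⟨e ≪≫ₗ f⟩
  · obtain ⟨e⟩ := key b (by lia)
    exact hN₁.map e.trans
  · obtain ⟨e⟩ := key (b + 1) (by lia)
    exact hN₂.map e.trans
  · have := hN i hib hib'
    have := hI.subsingleton i hia
    exact Ext.subsingleton_X₂ _ hS

end Ideal

namespace MvPolynomial

variable {σ : Type u} (R : Type u) [CommRing R] (m : ℕ)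

/-- The ideal generated by the `m`-th powers of the variables in `s`. -/
def powIdeal (s : Set σ) : Ideal (MvPolynomial σ R) :=
  Ideal.span ((fun i ↦ X i ^ m) '' s)

variable {R m}

lemma mem_powIdeal {s : Set σ} {f : MvPolynomial σ R} :
    f ∈ powIdeal R m s ↔ ∀ d ∈ f.support, ∃ i ∈ s, m ≤ d i := by
  have := mem_ideal_span_monomial_image (x := f) (s := (fun i ↦ Finsupp.single i m) '' s)
  rw [Set.image_image] at this
  simpa [powIdeal, X_pow_eq_monomial] using this

lemma powIdeal_union (s t : Set σ) : powIdeal R m (s ∪ t) = powIdeal R m s ⊔ powIdeal R m t := by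
  rw [powIdeal, Set.image_union, Ideal.span_union, powIdeal, powIdeal]

lemma powIdeal_inf {s t : Set σ} (h : Disjoint s t) :
    powIdeal R m s ⊓ powIdeal R m t = powIdeal R m s * powIdeal R m t := by
  refine le_antisymm ?_ Ideal.mul_le_inf
  rintro f ⟨hs, ht⟩
  have hmul : powIdeal R m s * powIdeal R m t = Ideal.span ((fun d ↦ monomial d (1 : R)) ''
      ((fun p : σ × σ ↦ Finsupp.single p.1 m + Finsupp.single p.2 m) '' s ×ˢ t)) := by
    rw [powIdeal, powIdeal, Ideal.span_mul_span', Set.image_image, ← Set.image2_mul,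
      Set.image2_image_left, Set.image2_image_right, ← Set.image_uncurry_prod]
    congr 1
    refine Set.image_congr fun p _ ↦ ?_
    simp [Function.uncurry, X_pow_eq_monomial, monomial_mul]
  rw [hmul, mem_ideal_span_monomial_image]
  intro d hd
  obtain ⟨i, hi, hid⟩ := mem_powIdeal.1 hs d hd
  obtain ⟨j, hj, hjd⟩ := mem_powIdeal.1 ht d hd
  refine ⟨_, ⟨(i, j), ⟨hi, hj⟩, rfl⟩, fun k ↦ ?_⟩
  have hij : i ≠ j := h.ne_of_mem hi hj
  classical
  simp only [Finsupp.add_apply, Finsupp.single_apply]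
  grind

lemma isSMulRegular_quotient_powIdeal {s : Set σ} {j : σ} (hj : j ∉ s) :
    IsSMulRegular (MvPolynomial σ R ⧸ powIdeal R m s) (X j ^ m : MvPolynomial σ R) := by
  rw [isSMulRegular_quotient_iff_mem_of_smul_mem]
  intro f hf
  rw [mem_powIdeal] at hf ⊢
  intro d hd
  obtain ⟨i, hi, hid⟩ := hf (Finsupp.single j m + d) (by
    rw [smul_eq_mul, X_pow_eq_monomial, mem_support_iff, coeff_monomial_mul, one_mul]
    exact mem_support_iff.1 hd)
  refine ⟨i, hi, ?_⟩
  rwa [Finsupp.add_apply, Finsupp.single_eq_of_ne (by grind), zero_add] at hid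

lemma isExtSelfDual_quotient_powIdeal (s : Finset σ) :
    IsExtSelfDual (MvPolynomial σ R) (MvPolynomial σ R ⧸ powIdeal R m s) s.card := by
  classical
  induction s using Finset.induction_on with
  | empty =>
    refine IsExtSelfDual.self.of_linearEquiv (Submodule.quotEquivOfEqBot _ ?_).symm
    simp [powIdeal]
  | insert j s hj ih =>
    rw [Finset.card_insert_of_notMem hj]
    have h := ih.quotient_sup_span (isSMulRegular_quotient_powIdeal (by simpa using hj))
    rwa [← Set.image_singleton (f := fun i ↦ (X i : MvPolynomial σ R) ^ m), ← powIdeal,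
      ← powIdeal_union, Set.union_singleton, ← Finset.coe_insert] at h

end MvPolynomial

end

open Pointwise in
lemma Set.pair_mul_insert_insert_insert_pair {M : Type*} [CommMonoid M] (a b c d e f g : M) :
    ({f, g} : Set M) * {a, b, c, d, e} =
      {g * e, d * g, c * g, b * g, a * g, f * e, d * f, c * f, b * f, a * f} := by
  ext x
  simp only [Set.mem_mul, Set.mem_insert_iff, Set.mem_singleton_iff, exists_eq_or_imp,
    exists_eq_left, mul_comm f, mul_comm g, eq_comm (b := x)]
  grind

lemma J7_eq_inf (m : ℕ) : J7 m = powIdeal ℂ m {4, 5} ⊓ powIdeal ℂ m {0, 1, 2, 3, 6} := by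
  rw [powIdeal_inf (by simp), powIdeal, powIdeal, Ideal.span_mul_span', J7]
  simp only [Set.image_insert_eq, Set.image_singleton, mul_pow]
  rw [Set.pair_mul_insert_insert_insert_pair]

/-- `ExtJ7` in terms of the `Ext` modules defined through the derived category. -/
def extJ7LinearEquiv (i m : ℕ) : ExtJ7 (i + 1) m ≃ₗ[S7]
    Abelian.Ext (ModuleCat.of S7 (S7 ⧸ powIdeal ℂ m {4, 5} ⊓ powIdeal ℂ m {0, 1, 2, 3, 6}))
      (ModuleCat.of S7 S7) (i + 1) :=
  (projectiveResolution (ModuleCat.of S7 (S7 ⧸ J7 m))).extObjLinearEquiv S7 _ i ≪≫ₗ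
    (Abelian.Ext.precompLinearEquiv S7 _
      (Submodule.quotEquivOfEq _ _ (J7_eq_inf m)).toModuleIso _).symm

/-- Computation of the modules `Ext^i_S(S/J_m, S)` for the example of the blowup of
`ℙ(1,1,1,3,3,6)` (Example 2; `x_i` is `X (i-1)`). -/
theorem ext_computation_example_two (m : ℕ) (hm : 1 ≤ m) :
    Nonempty (ExtJ7 2 m ≃ₗ[S7] (S7 ⧸ Ideal.span {(X 4 : S7) ^ m, (X 5 : S7) ^ m})) ∧
    Subsingleton (ExtJ7 3 m) ∧
    Subsingleton (ExtJ7 4 m) ∧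
    Nonempty (ExtJ7 5 m ≃ₗ[S7] (S7 ⧸ Ideal.span {(X 0 : S7) ^ m, (X 1 : S7) ^ m,
      (X 2 : S7) ^ m, (X 3 : S7) ^ m, (X 6 : S7) ^ m})) ∧
    Nonempty (ExtJ7 6 m ≃ₗ[S7] (S7 ⧸ Ideal.span {(X 0 : S7) ^ m, (X 1 : S7) ^ m,
      (X 2 : S7) ^ m, (X 3 : S7) ^ m, (X 4 : S7) ^ m, (X 5 : S7) ^ m,
      (X 6 : S7) ^ m})) := by
  have hIK : powIdeal ℂ m ({4, 5} : Set (Fin 7)) ⊔ powIdeal ℂ m {0, 1, 2, 3, 6} =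
      powIdeal ℂ m {0, 1, 2, 3, 4, 5, 6} := by
    rw [← powIdeal_union]
    congr 1
    grind
  have h₁ := isExtSelfDual_quotient_powIdeal (R := ℂ) (m := m) ({4, 5} : Finset (Fin 7))
  have h₂ := isExtSelfDual_quotient_powIdeal (R := ℂ) (m := m) ({0, 1, 2, 3, 6} : Finset (Fin 7))
  have h₃ := isExtSelfDual_quotient_powIdeal (R := ℂ) (m := m)
    ({0, 1, 2, 3, 4, 5, 6} : Finset (Fin 7))
  rw [Finset.coe_pair] at h₁
  iterate 4 rw [Finset.coe_insert] at h₂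
  iterate 6 rw [Finset.coe_insert] at h₃
  rw [Finset.coe_singleton] at h₂ h₃
  rw [← hIK] at h₃
  obtain ⟨⟨e₂⟩, ⟨e₅⟩, ⟨e₆⟩, h⟩ :=
    Ideal.ext_quotient_inf _ _ h₁ h₂ h₃ (by decide) (by decide)
  have := h 3 (by decide) (by decide) (by decide)
  have := h 4 (by decide) (by decide) (by decide)
  refine ⟨⟨extJ7LinearEquiv 1 m ≪≫ₗ e₂ ≪≫ₗ Submodule.quotEquivOfEq _ _ ?_⟩,
    (extJ7LinearEquiv 2 m).toEquiv.subsingleton, (extJ7LinearEquiv 3 m).toEquiv.subsingleton,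
    ⟨extJ7LinearEquiv 4 m ≪≫ₗ e₅ ≪≫ₗ Submodule.quotEquivOfEq _ _ ?_⟩,
    ⟨extJ7LinearEquiv 5 m ≪≫ₗ e₆ ≪≫ₗ Submodule.quotEquivOfEq _ _ (hIK.trans ?_)⟩⟩ <;>
  simp [powIdeal, Set.image_insert_eq]
end
end
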